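/- arXiv:2506.04407 — 3 statements merged into one kernel-verified Lean document; each statement's English description precedes it below -/
import Mathlib

section
/- Let k ≥ 4. For every n ∈ ℕ, every return word to the bispecial factor w = ξ^{n+2k−1}(0)ξ^n(0) in u_k has length at least |w|. -/
open List Filter Topology

/-- The alphabet `A`: the letter `(b, j)` is the unprimed letter `j` if `b = false`
and the primed letter `j′` if `b = true`.  Only letters with `j < k` occur. -/
abbrev Letter : Type := Bool × ℕ

/-- The morphism ξ_k on letters: `0 ↦ 01`, `j ↦ j+1` for `1 ≤ j ≤ k−2`, `k−1 ↦ 0′`,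
and symmetrically on primed letters with `(k−1)′ ↦ 0`. -/
def xiL (k : ℕ) (a : Letter) : List Letter :=
  if a.2 = 0 then [(a.1, 0), (a.1, 1)]
  else if a.2 = k - 1 then [(!a.1, 0)]
  else [(a.1, a.2 + 1)]

/-- The morphism ξ_k on finite words. -/
def xiW (k : ℕ) (w : List Letter) : List Letter := w.flatMap (xiL k)

/-- The word ξ_k^n(0). -/
def xiPow (k n : ℕ) : List Letter := (xiW k)^[n] [((false : Bool), (0 : ℕ))]

/-- The projection π : A → {0,1}, with `false` playing the role of `0` and
`true` the role of `1`. -/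
def proj (a : Letter) : Bool := if a.2 = 0 then a.1 else !a.1

/-- The twin map `ℓ ↔ ℓ′` on letters. -/
def twin (a : Letter) : Letter := (!a.1, a.2)

/-- The finite word `w` occurs in the infinite word `v` at position `j`. -/
def OccursAt {α : Type*} (w : List α) (v : ℕ → α) (j : ℕ) : Prop :=
  ∀ i, i < w.length → w[i]? = some (v (j + i))

/-- The finite word `w` is a prefix of the infinite word `v`. -/
def PrefixSeq {α : Type*} (w : List α) (v : ℕ → α) : Prop := OccursAt w v 0

/-- The finite word `w` is a factor of the infinite word `v`. -/
def FactorOf {α : Type*} (w : List α) (v : ℕ → α) : Prop := ∃ j, OccursAt w v j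

/-- `v` is the fixed point `u_k = ξ_k^ω(0)`: every `ξ_k^n(0)` is a prefix of `v`. -/
def IsFixedPoint (k : ℕ) (v : ℕ → Letter) : Prop := ∀ n, PrefixSeq (xiPow k n) v

/-- `q ≥ 1` is a period of the finite word `z`. -/
def HasPeriod {α : Type*} (z : List α) (q : ℕ) : Prop :=
  1 ≤ q ∧ ∀ i, i + q < z.length → z[i]? = z[i + q]?

/-- `w` is a left special factor of the infinite word `v`. -/
def LeftSpecial {α : Type*} (w : List α) (v : ℕ → α) : Prop :=
  ∃ a b : α, a ≠ b ∧ FactorOf (a :: w) v ∧ FactorOf (b :: w) v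

/-- `w` is a right special factor of the infinite word `v`. -/
def RightSpecial {α : Type*} (w : List α) (v : ℕ → α) : Prop :=
  ∃ a b : α, a ≠ b ∧ FactorOf (w ++ [a]) v ∧ FactorOf (w ++ [b]) v

/-- `w` is a bispecial factor of the infinite word `v`. -/
def Bispecial {α : Type*} (w : List α) (v : ℕ → α) : Prop :=
  LeftSpecial w v ∧ RightSpecial w v

/-- The set of left extensions of `w` in `v`. -/
def Lext {α : Type*} (w : List α) (v : ℕ → α) : Set α := {a | FactorOf (a :: w) v}

/-- The set of right extensions of `w` in `v`. -/
def Rext {α : Type*} (w : List α) (v : ℕ → α) : Set α := {a | FactorOf (w ++ [a]) v}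

/-- `r` is a return word to `w` in `v`: it spans two consecutive occurrences of `w`. -/
def ReturnWordTo {α : Type*} (r w : List α) (v : ℕ → α) : Prop :=
  ∃ j ℓ, j < ℓ ∧ OccursAt w v j ∧ OccursAt w v ℓ ∧
    (∀ m, j < m → m < ℓ → ¬ OccursAt w v m) ∧
    r = (List.range (ℓ - j)).map (fun i => v (j + i))

/-- The factor complexity of an infinite word. -/
noncomputable def complexity {α : Type*} (v : ℕ → α) (n : ℕ) : ℕ :=
  {w : List α | w.length = n ∧ FactorOf w v}.ncard

theorem occursAt_append {α : Type*} {x y : List α} {v : ℕ → α} {p : ℕ} :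
    OccursAt (x ++ y) v p ↔ OccursAt x v p ∧ OccursAt y v (p + x.length) := by
  constructor
  · intro h
    refine ⟨fun i hi => ?_, fun i hi => ?_⟩
    · have := h i (by simp; omega)
      rwa [List.getElem?_append_left hi] at this
    · have := h (x.length + i) (by simp; omega)
      rw [List.getElem?_append_right (by omega)] at this
      simpa [add_assoc] using this
  · rintro ⟨h₁, h₂⟩ i hi
    by_cases hx : i < x.length
    · rw [List.getElem?_append_left hx]
      exact h₁ i hx
    · have := h₂ (i - x.length) (by simp at hi; omega)
      rw [List.getElem?_append_right (by omega), this]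
      congr 2
      omega

theorem occursAt_singleton {α : Type*} {a : α} {v : ℕ → α} {p : ℕ} :
    OccursAt [a] v p ↔ v p = a := by
  simp [OccursAt, eq_comm]

theorem occursAt_cons {α : Type*} {a : α} {x : List α} {v : ℕ → α} {p : ℕ} :
    OccursAt (a :: x) v p ↔ v p = a ∧ OccursAt x v (p + 1) := by
  rw [← List.singleton_append, occursAt_append, occursAt_singleton, List.length_singleton]

theorem occursAt_nil {α : Type*} {v : ℕ → α} {p : ℕ} : OccursAt [] v p := by
  simp [OccursAt]

theorem xiW_append (k : ℕ) (x y : List Letter) : xiW k (x ++ y) = xiW k x ++ xiW k y := by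
  simp [xiW]

theorem xiW_cons (k : ℕ) (a : Letter) (x : List Letter) : xiW k (a :: x) = xiL k a ++ xiW k x := by
  simp [xiW]

theorem xiW_nil (k : ℕ) : xiW k [] = [] := rfl

theorem xiW_singleton (k : ℕ) (a : Letter) : xiW k [a] = xiL k a := by
  simp [xiW]

/-- The first letter of `ξ(a)`. -/
def xiFirst (k : ℕ) (a : Letter) : Letter :=
  if a.2 = 0 then a else if a.2 = k - 1 then (!a.1, 0) else (a.1, a.2 + 1)

theorem xiL_eq (k : ℕ) (a : Letter) :
    xiL k a = if a.2 = 0 then [xiFirst k a, (a.1, 1)] else [xiFirst k a] := by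
  obtain ⟨b, j⟩ := a
  unfold xiL xiFirst
  split_ifs <;> simp_all

theorem xiFirst_snd_ne_one (k : ℕ) (a : Letter) : (xiFirst k a).2 ≠ 1 := by
  unfold xiFirst
  split_ifs <;> simp_all

/-- The word `ξ^n(b)`, where `b` is the letter `0` or `0′`. -/
def xiIter (k : ℕ) (b : Bool) (n : ℕ) : List Letter := (xiW k)^[n] [(b, 0)]

theorem xiIter_succ (k : ℕ) (b : Bool) (n : ℕ) : xiIter k b (n + 1) = xiW k (xiIter k b n) :=
  Function.iterate_succ_apply' _ _ _

theorem xiW_iterate_append (k n : ℕ) (x y : List Letter) :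
    (xiW k)^[n] (x ++ y) = (xiW k)^[n] x ++ (xiW k)^[n] y := by
  induction n generalizing x y with
  | zero => rfl
  | succ n ih => simp [xiW_append, ih]

theorem xiW_iterate_one {k : ℕ} (b : Bool) {j : ℕ} (hj : j + 2 ≤ k) :
    (xiW k)^[j] [(b, 1)] = [(b, j + 1)] := by
  induction j with
  | zero => rfl
  | succ j ih =>
    rw [Function.iterate_succ_apply', ih (by omega), xiW_singleton, xiL,
      if_neg (by simp), if_neg (by simp; omega)]

theorem xiIter_add {k : ℕ} (hk : 2 ≤ k) (b : Bool) (n : ℕ) :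
    xiIter k b (n + k) = xiIter k b (n + k - 1) ++ xiIter k (!b) n := by
  have h₁ : (xiW k)^[k - 1] [(b, 1)] = [(!b, 0)] := by
    obtain ⟨j, rfl⟩ : ∃ j, k = j + 2 := ⟨k - 2, by omega⟩
    rw [show j + 2 - 1 = j + 1 by omega, Function.iterate_succ_apply',
      xiW_iterate_one b le_rfl, xiW_singleton]
    simp [xiL]
  have h₂ : n + k = (n + (k - 1)) + 1 := by omega
  rw [xiIter, h₂, Function.iterate_succ_apply, xiW_singleton,
    show xiL k (b, 0) = [(b, 0)] ++ [(b, 1)] by simp [xiL], xiW_iterate_append,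
    Function.iterate_add_apply _ n (k - 1) [(b, 1)], h₁]
  rfl

theorem xiIter_self {k : ℕ} (hk : 2 ≤ k) (b : Bool) :
    xiIter k b k = xiIter k b (k - 1) ++ [(!b, 0)] := by
  simpa [xiIter] using xiIter_add hk b 0

theorem xiIter_eq_append_last {k : ℕ} (hk : 2 ≤ k) (b : Bool) (n : ℕ) :
    ∃ z e, xiIter k b n = z ++ [(e, n % k)] ∧ (n < k → e = b) := by
  induction n with
  | zero => exact ⟨[], b, by simp [xiIter], fun _ => rfl⟩
  | succ n ih =>
    obtain ⟨z, e, hz, he⟩ := ih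
    have hlt := Nat.mod_lt n (show 0 < k by omega)
    rw [xiIter_succ, hz, xiW_append, xiW_singleton]
    by_cases h₀ : n % k = 0
    · refine ⟨xiW k z ++ [(e, 0)], e, ?_, fun h => he (by omega)⟩
      rw [Nat.add_mod, h₀, Nat.mod_eq_of_lt (show 1 < k by omega), Nat.zero_add,
        Nat.mod_eq_of_lt (show 1 < k by omega)]
      simp [xiL]
    · by_cases h₁ : n % k = k - 1
      · refine ⟨xiW k z, !e, ?_, fun h => ?_⟩
        · have h₂ : (n + 1) % k = 0 := by
            rw [Nat.add_mod, h₁, Nat.mod_eq_of_lt (show 1 < k by omega), Nat.sub_add_cancel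
              (by omega), Nat.mod_self]
          simp [xiL, h₁, h₂, show k - 1 ≠ 0 by omega]
        · rw [Nat.mod_eq_of_lt (by omega)] at h₁
          omega
      · refine ⟨xiW k z, e, ?_, fun h => he (by omega)⟩
        have h₂ : (n + 1) % k = n % k + 1 := by
          rw [Nat.add_mod, Nat.mod_eq_of_lt (show 1 < k by omega), Nat.mod_eq_of_lt (by omega)]
        simp [xiL, h₀, h₁, h₂]

theorem xiIter_ne_nil {k : ℕ} (hk : 2 ≤ k) (b : Bool) (n : ℕ) : xiIter k b n ≠ [] := by
  obtain ⟨z, e, h, -⟩ := xiIter_eq_append_last hk b n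
  simp [h]

theorem OccursAt.last_xiIter {k : ℕ} (hk : 2 ≤ k) {b : Bool} {n p : ℕ} {u : ℕ → Letter}
    (h : OccursAt (xiIter k b n) u p) :
    ∃ q, p + (xiIter k b n).length = q + 1 ∧ (u q).2 = n % k ∧ (n < k → (u q).1 = b) := by
  obtain ⟨z, e, hz, he⟩ := xiIter_eq_append_last hk b n
  rw [hz, occursAt_append, occursAt_singleton] at h
  refine ⟨p + z.length, by simp [hz, add_assoc], by simp [h.2], fun hn => ?_⟩
  simp [h.2, he hn]

theorem xiIter_eq_cons_of_lt {k : ℕ} (b : Bool) {s : ℕ} (hs : s < k) :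
    ∃ t, xiIter k b s = (b, 0) :: t ∧ ∀ a ∈ t, a.1 = b ∧ a.2 ≠ 0 ∧ a.2 ≤ s := by
  induction s with
  | zero => exact ⟨[], rfl, by simp⟩
  | succ s ih =>
    obtain ⟨t, ht, h⟩ := ih (by omega)
    refine ⟨(b, 1) :: xiW k t, ?_, fun a ha => ?_⟩
    · rw [xiIter_succ, ht, xiW_cons]
      simp [xiL]
    · rcases List.mem_cons.1 ha with rfl | ha
      · simp
      · obtain ⟨c, hc, hac⟩ := List.mem_flatMap.1 ha
        obtain ⟨h₁, h₂, h₃⟩ := h c hc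
        rw [xiL, if_neg h₂, if_neg (by omega), List.mem_singleton] at hac
        subst hac
        exact ⟨h₁, by simp, by simpa using h₃⟩

theorem xiIter_add_eq_cons {k : ℕ} (hk : 2 ≤ k) (b : Bool) {m : ℕ} (hm : m < k) :
    ∃ t, xiIter k b (m + k) = (b, 0) :: t ∧ (b, 0) ∉ t := by
  induction m with
  | zero =>
    obtain ⟨t, ht, h⟩ := xiIter_eq_cons_of_lt b (show k - 1 < k by omega)
    refine ⟨t ++ [(!b, 0)], by rw [zero_add, xiIter_self hk, ht]; rfl, fun hmem => ?_⟩
    rcases List.mem_append.1 hmem with hmem | hmem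
    · exact (h _ hmem).2.1 rfl
    · simp at hmem
  | succ m ih =>
    obtain ⟨t, ht, h⟩ := ih (by omega)
    obtain ⟨t', ht', hbit⟩ := xiIter_eq_cons_of_lt (!b) hm
    refine ⟨t ++ (!b, 0) :: t', ?_, fun hmem => ?_⟩
    · rw [xiIter_add hk, show m + 1 + k - 1 = m + k by omega, ht, ht']
      rfl
    · rcases List.mem_append.1 hmem with hmem | hmem
      · exact h hmem
      · rcases List.mem_cons.1 hmem with hmem | hmem
        · simp at hmem
        · simpa using (hbit _ hmem).1

/-- `φ i` is the position at which the block `ξ(u_i)` starts in `u = ξ(u)`. -/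
structure IsCutting (k : ℕ) (u : ℕ → Letter) (φ : ℕ → ℕ) : Prop where
  zero : φ 0 = 0
  succ : ∀ i, φ (i + 1) = φ i + (xiL k (u i)).length
  occ : ∀ i, OccursAt (xiL k (u i)) u (φ i)

theorem lt_length_xiPow (k n : ℕ) : ∃ t, xiPow k n = (false, 0) :: t ∧ n ≤ t.length := by
  have hpos : ∀ x : List Letter, x.length ≤ (xiW k x).length := by
    intro x
    induction x with
    | nil => simp
    | cons a x ih =>
      rw [xiW_cons, xiL_eq]
      split_ifs <;> simp <;> omega
  induction n with
  | zero => exact ⟨[], rfl, le_rfl⟩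
  | succ n ih =>
    obtain ⟨t, ht, hn⟩ := ih
    refine ⟨(false, 1) :: xiW k t, ?_, ?_⟩
    · rw [xiPow, Function.iterate_succ_apply', ← xiPow, ht, xiW_cons]
      simp [xiL]
    · have := hpos t
      simp
      omega

theorem IsFixedPoint.exists_isCutting {k : ℕ} {u : ℕ → Letter} (hu : IsFixedPoint k u) :
    ∃ φ, IsCutting k u φ := by
  refine ⟨fun i => (xiW k ((List.range i).map u)).length, rfl, fun i => ?_, fun i => ?_⟩
  · simp [List.range_succ, xiW_append, xiW_singleton]
  · obtain ⟨t, ht, hn⟩ := lt_length_xiPow k i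
    have hlen : i < (xiPow k i).length := by simp [ht]; omega
    have htake : (List.range i).map u ++ [u i] = (xiPow k i).take (i + 1) := by
      refine List.ext_getElem? fun m => ?_
      rw [← List.map_singleton, ← List.map_append, ← List.range_succ]
      by_cases hm : m < i + 1
      · have := hu i m (by omega)
        rw [List.getElem?_take_of_lt hm, this]
        simp [hm]
      · rw [List.getElem?_eq_none (by simp; omega), List.getElem?_eq_none (by simp; omega)]
    have hocc := hu (i + 1)
    rw [xiPow, Function.iterate_succ_apply', ← xiPow, ← List.take_append_drop (i + 1) (xiPow k i),
      ← htake, xiW_append, xiW_append, xiW_singleton, PrefixSeq, occursAt_append,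
      occursAt_append] at hocc
    simpa using hocc.1.2

namespace IsCutting

variable {k : ℕ} {u : ℕ → Letter} {φ : ℕ → ℕ}

theorem apply_first (h : IsCutting k u φ) (i : ℕ) : u (φ i) = xiFirst k (u i) := by
  have := h.occ i
  rw [xiL_eq] at this
  split_ifs at this
  · exact (occursAt_cons.1 this).1
  · exact occursAt_singleton.1 this

theorem apply_second (h : IsCutting k u φ) {i : ℕ} (hi : (u i).2 = 0) :
    u (φ i + 1) = ((u i).1, 1) := by
  have := h.occ i
  rw [xiL_eq, if_pos hi] at this
  exact occursAt_singleton.1 (occursAt_cons.1 this).2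

theorem succ_of_zero (h : IsCutting k u φ) {i : ℕ} (hi : (u i).2 = 0) : φ (i + 1) = φ i + 2 := by
  rw [h.succ, xiL_eq, if_pos hi]
  rfl

theorem succ_of_ne_zero (h : IsCutting k u φ) {i : ℕ} (hi : (u i).2 ≠ 0) :
    φ (i + 1) = φ i + 1 := by
  rw [h.succ, xiL_eq, if_neg hi]
  rfl

theorem strictMono (h : IsCutting k u φ) : StrictMono φ := by
  refine strictMono_nat_of_lt_succ fun i => ?_
  by_cases hi : (u i).2 = 0
  · rw [h.succ_of_zero hi]
    omega
  · rw [h.succ_of_ne_zero hi]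
    omega

theorem exists_eq (h : IsCutting k u φ) (p : ℕ) :
    ∃ i, p = φ i ∨ (p = φ i + 1 ∧ (u i).2 = 0) := by
  induction p with
  | zero => exact ⟨0, Or.inl h.zero.symm⟩
  | succ p ih =>
    obtain ⟨i, rfl | ⟨rfl, hi⟩⟩ := ih
    · by_cases hi : (u i).2 = 0
      · exact ⟨i, Or.inr ⟨rfl, hi⟩⟩
      · exact ⟨i + 1, Or.inl (h.succ_of_ne_zero hi).symm⟩
    · exact ⟨i + 1, Or.inl (h.succ_of_zero hi).symm⟩

theorem exists_eq_of_ne_one (h : IsCutting k u φ) {p : ℕ} (hp : (u p).2 ≠ 1) : ∃ i, p = φ i := by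
  obtain ⟨i, rfl | ⟨rfl, hi⟩⟩ := h.exists_eq p
  · exact ⟨i, rfl⟩
  · simp [h.apply_second hi] at hp

theorem snd_lt (h : IsCutting k u φ) (hk : 2 ≤ k) (p : ℕ) : (u p).2 < k := by
  suffices H : ∀ t p, (u p).2 ≠ k + t by
    by_contra hp
    exact H ((u p).2 - k) p (by omega)
  intro t
  induction t with
  | zero =>
    intro p hp
    obtain ⟨i, rfl⟩ := h.exists_eq_of_ne_one (p := p) (by omega)
    rw [h.apply_first] at hp
    unfold xiFirst at hp
    split_ifs at hp <;> simp at hp <;> omega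
  | succ t ih =>
    intro p hp
    obtain ⟨i, rfl⟩ := h.exists_eq_of_ne_one (p := p) (by omega)
    rw [h.apply_first] at hp
    have := ih i
    unfold xiFirst at hp
    split_ifs at hp <;> (try simp only at hp) <;> omega

/-- Every letter `j + 1` is preceded by the letter `j`. -/
theorem exists_pred (h : IsCutting k u φ) (hk : 2 ≤ k) {p j : ℕ} (hp : (u p).2 = j + 1) :
    ∃ q, p = q + 1 ∧ u q = ((u p).1, j) := by
  induction j generalizing p with
  | zero =>
    obtain ⟨i, rfl | ⟨rfl, hi⟩⟩ := h.exists_eq p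
    · rw [h.apply_first] at hp
      exact absurd hp (xiFirst_snd_ne_one _ _)
    · refine ⟨φ i, rfl, ?_⟩
      rw [h.apply_first, h.apply_second hi, xiFirst, if_pos hi, ← hi]
  | succ j ih =>
    obtain ⟨i, rfl⟩ := h.exists_eq_of_ne_one (p := p) (by omega)
    have hlt := h.snd_lt hk (φ i)
    rw [h.apply_first] at hp hlt ⊢
    have hi : (u i).2 = j + 1 ∧ (xiFirst k (u i)).1 = (u i).1 := by
      unfold xiFirst at hp ⊢
      split_ifs at hp ⊢ <;> simp at hp ⊢ <;> omega
    obtain ⟨q, rfl, hq⟩ := ih hi.1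
    rw [hi.2]
    by_cases h₀ : (u q).2 = 0
    · refine ⟨φ q + 1, by rw [h.succ_of_zero h₀], ?_⟩
      rw [h.apply_second h₀]
      simp_all
    · refine ⟨φ q, by rw [h.succ_of_ne_zero h₀], ?_⟩
      rw [h.apply_first, xiFirst, if_neg h₀, if_neg (by simp [hq]; omega), hq]

/-- Two consecutive letters from `{0, 0′}` are preceded by `k - 1` or its twin. -/
theorem snd_eq_of_zero_zero (h : IsCutting k u φ) (hk : 3 ≤ k) {p : ℕ}
    (h₁ : (u (p + 1)).2 = 0) (h₂ : (u (p + 2)).2 = 0) : (u p).2 = k - 1 := by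
  obtain ⟨i, hi⟩ := h.exists_eq_of_ne_one (p := p + 1) (by omega)
  have hi' : (u i).2 = (k - 2) + 1 := by
    have hf := h.apply_first i
    rw [← hi] at hf
    by_contra hne
    by_cases h₀ : (u i).2 = 0
    · have := h.apply_second h₀
      rw [← hi] at this
      rw [this] at h₂
      simp at h₂
    · rw [hf, xiFirst, if_neg h₀, if_neg (by omega)] at h₁
      simp at h₁
  obtain ⟨q, rfl, hq⟩ := h.exists_pred (by omega) hi'
  rw [h.succ_of_ne_zero (by simp [hq]; omega)] at hi
  rw [Nat.succ_injective hi, h.apply_first, xiFirst, if_neg (by simp [hq]; omega),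
    if_neg (by simp [hq]; omega), hq]
  simp
  omega

theorem desubstitute_aux (h : IsCutting k u φ) {x : List Letter} {i : ℕ}
    (hx : OccursAt (xiW k x) u (φ i)) (hn : (u (φ i + (xiW k x).length)).2 ≠ 1) :
    OccursAt x u i ∧ φ (i + x.length) = φ i + (xiW k x).length := by
  induction x generalizing i with
  | nil => exact ⟨occursAt_nil, by simp [xiW_nil]⟩
  | cons a x ih =>
    rw [xiW_cons, occursAt_append] at hx
    have hnext : (u (φ i + (xiL k a).length)).2 ≠ 1 := by
      cases x with
      | nil => simpa [xiW_cons, xiW_nil] using hn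
      | cons c x =>
        have := hx.2
        rw [xiW_cons, occursAt_append, xiL_eq k c] at this
        have h₁ : u (φ i + (xiL k a).length) = xiFirst k c := by
          have := this.1
          split_ifs at this
          · exact (occursAt_cons.1 this).1
          · exact occursAt_singleton.1 this
        rw [h₁]
        exact xiFirst_snd_ne_one _ _
    have hua : u i = a := by
      have hx₁ := hx.1
      have hf := h.apply_first i
      by_cases ha : a.2 = 0
      · rw [xiL_eq, if_pos ha, occursAt_cons, occursAt_singleton] at hx₁
        have h₀ : (u i).2 = 0 := by
          by_contra h₀
          have := h.apply_first (i + 1)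
          rw [h.succ_of_ne_zero h₀, hx₁.2] at this
          exact xiFirst_snd_ne_one _ _ (congrArg Prod.snd this).symm
        rw [hx₁.1, xiFirst, xiFirst, if_pos ha, if_pos h₀] at hf
        exact hf.symm
      · rw [xiL_eq, if_neg ha] at hx₁ hnext
        rw [occursAt_singleton] at hx₁
        have h₀ : (u i).2 ≠ 0 := by
          intro h₀
          simp [h.apply_second h₀] at hnext
        rw [hx₁, xiFirst, xiFirst, if_neg ha, if_neg h₀] at hf
        ext
        · split_ifs at hf <;> simp_all
        · split_ifs at hf <;> simp_all
    have hs := h.succ i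
    rw [hua] at hs
    have := ih (i := i + 1) (by rw [hs]; exact hx.2) (by
      rw [hs]
      simpa [xiW_cons, add_assoc] using hn)
    refine ⟨occursAt_cons.2 ⟨hua, this.1⟩, ?_⟩
    rw [List.length_cons, show i + (x.length + 1) = i + 1 + x.length by omega, this.2, hs,
      xiW_cons, List.length_append, add_assoc]

theorem desubstitute (h : IsCutting k u φ) {x : List Letter} (hne : x ≠ []) {p : ℕ}
    (hx : OccursAt (xiW k x) u p) (hn : (u (p + (xiW k x).length)).2 ≠ 1) :
    ∃ i, p = φ i ∧ OccursAt x u i ∧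
      u (p + (xiW k x).length) = xiFirst k (u (i + x.length)) := by
  obtain ⟨a, t, rfl⟩ := List.exists_cons_of_ne_nil hne
  have hp : u p = xiFirst k a := by
    have := hx
    rw [xiW_cons, occursAt_append, xiL_eq] at this
    have := this.1
    split_ifs at this
    · exact (occursAt_cons.1 this).1
    · exact occursAt_singleton.1 this
  obtain ⟨i, rfl⟩ := h.exists_eq_of_ne_one (p := p) (by rw [hp]; exact xiFirst_snd_ne_one _ _)
  obtain ⟨h₁, h₂⟩ := h.desubstitute_aux hx hn
  exact ⟨i, rfl, h₁, by rw [← h₂, h.apply_first]⟩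

theorem snd_ne_one_of_prev (h : IsCutting k u φ) (hk : 2 ≤ k) {q : ℕ} (hq : (u q).2 ≠ 0) :
    (u (q + 1)).2 ≠ 1 := by
  intro h₁
  obtain ⟨q', hq', h₂⟩ := h.exists_pred hk (j := 0) h₁
  obtain rfl : q = q' := by omega
  simp [h₂] at hq

theorem mod_eq_of_xiIter_append (h : IsCutting k u φ) (hk : 2 ≤ k) {x : List Letter} {b : Bool}
    {n p j : ℕ} (ho : OccursAt (x ++ xiIter k b n) u p)
    (hn : (u (p + (x ++ xiIter k b n).length)).2 = j + 1) :
    n % k = j ∧ (n < k → (u (p + (x ++ xiIter k b n).length)).1 = b) := by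
  obtain ⟨q, hq, h₁, h₂⟩ := (occursAt_append.1 ho).2.last_xiIter hk
  obtain ⟨q', hq', h₃⟩ := h.exists_pred hk hn
  rw [List.length_append, ← add_assoc] at hq' ⊢
  obtain rfl : q = q' := by omega
  rw [h₃, List.length_append, ← add_assoc] at h₁ h₂
  exact ⟨h₁.symm, h₂⟩

theorem not_followed_by_zero (h : IsCutting k u φ) (hk : 3 ≤ k) {s t p : ℕ} {b b' : Bool}
    (hs : s % k ≠ k - 1) (ht : t + 2 ≤ k)
    (ho : OccursAt (xiIter k b (t + s) ++ xiIter k b' t) u p) :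
    (u (p + (xiIter k b (t + s) ++ xiIter k b' t).length)).2 ≠ 0 := by
  induction t generalizing p with
  | zero =>
    intro h₀
    obtain ⟨h₁, h₂⟩ := occursAt_append.1 ho
    obtain ⟨q, hq, h₃, -⟩ := h₁.last_xiIter (by omega)
    have h₄ : u (q + 1) = (b', 0) := by
      rw [← hq]
      exact occursAt_singleton.1 h₂
    rw [List.length_append, ← add_assoc, hq] at h₀
    have := h.snd_eq_of_zero_zero hk (p := q) (by simp [h₄]) h₀
    rw [zero_add] at h₃
    omega
  | succ t ih =>
    intro h₀
    rw [show t + 1 + s = t + s + 1 by omega, xiIter_succ, xiIter_succ, ← xiW_append] at ho h₀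
    obtain ⟨i, rfl, h₁, h₂⟩ := h.desubstitute
      (by simp [xiIter_ne_nil (show 2 ≤ k by omega)]) ho (by omega)
    have h₃ := ih (by omega) h₁
    rw [h₂, xiFirst, if_neg h₃] at h₀
    split_ifs at h₀ with h₄
    have := (h.mod_eq_of_xiIter_append (by omega) (j := k - 2) h₁ (by omega)).1
    rw [Nat.mod_eq_of_lt (by omega)] at this
    omega

theorem not_followed_by_one (h : IsCutting k u φ) (hk : 3 ≤ k) {s p : ℕ} {b b' : Bool}
    (hs : s % k ≠ k - 1) (ho : OccursAt (xiIter k b (k - 1 + s) ++ xiIter k b' k) u p) :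
    (u (p + (xiIter k b (k - 1 + s) ++ xiIter k b' k).length)).2 ≠ 1 := by
  intro h₁
  rw [xiIter_self (by omega), ← List.append_assoc] at ho h₁
  obtain ⟨q, hq, h₂⟩ := h.exists_pred (by omega) (j := 0) h₁
  have ho' := occursAt_append.1 ho
  rw [List.length_append, List.length_singleton, ← add_assoc] at hq h₁
  obtain rfl := Nat.succ_injective hq
  rw [occursAt_singleton] at ho'
  have h₃ : OccursAt (xiW k (xiIter k b (k - 2 + s) ++ xiIter k b' (k - 2) ++ [(!b', 0)])) u p := by
    rw [xiW_append, xiW_append, xiW_singleton, ← xiIter_succ, ← xiIter_succ,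
      show k - 2 + s + 1 = k - 1 + s by omega, show k - 2 + 1 = k - 1 by omega,
      show xiL k (!b', 0) = [(!b', 0)] ++ [(!b', 1)] by simp [xiL], ← List.append_assoc,
      occursAt_append]
    refine ⟨ho, occursAt_singleton.2 ?_⟩
    rw [List.length_append, List.length_singleton, ← add_assoc]
    rw [ho'.2, List.length_append, List.length_singleton, ← add_assoc] at h₂
    exact Prod.ext (congrArg Prod.fst h₂).symm h₁
  have hlen : (xiW k (xiIter k b (k - 2 + s) ++ xiIter k b' (k - 2) ++ [(!b', 0)])).length =
      (xiIter k b (k - 1 + s) ++ xiIter k b' (k - 1)).length + 2 := by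
    rw [xiW_append, xiW_append, xiW_singleton, ← xiIter_succ, ← xiIter_succ,
      show k - 2 + s + 1 = k - 1 + s by omega, show k - 2 + 1 = k - 1 by omega]
    simp [xiL, add_assoc]
  obtain ⟨i, -, h₄, -⟩ := h.desubstitute (by simp) h₃ (by
    rw [hlen]
    exact h.snd_ne_one_of_prev (by omega) (h₁.trans_ne one_ne_zero))
  rw [occursAt_append, occursAt_singleton] at h₄
  exact h.not_followed_by_zero hk hs (by omega) h₄.1 (congrArg Prod.snd h₄.2)

theorem xiIter_mul_not_followed_by_one (h : IsCutting k u φ) (hk : 3 ≤ k) {m p : ℕ} {b : Bool}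
    (ho : OccursAt (xiIter k b ((m + 2) * k)) u p) :
    (u (p + (xiIter k b ((m + 2) * k)).length)).2 ≠ 1 := by
  induction m generalizing p b with
  | zero =>
    rw [show (0 + 2) * k = k + k by ring, xiIter_add (by omega),
      show k + k - 1 = k - 1 + k by omega] at ho ⊢
    exact h.not_followed_by_one hk (by rw [Nat.mod_self]; omega) ho
  | succ m ih =>
    rw [show (m + 1 + 2) * k = (m + 2) * k + k by ring, xiIter_add (by omega)] at ho ⊢
    rw [List.length_append, ← add_assoc]
    exact ih (occursAt_append.1 ho).2

theorem bispecial_not_followed_by_one (h : IsCutting k u φ) (hk : 3 ≤ k) {n p : ℕ} {b b' : Bool}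
    (hn : 1 ≤ n) (ho : OccursAt (xiIter k b (n + 2 * k - 1) ++ xiIter k b' n) u p) :
    (u (p + (xiIter k b (n + 2 * k - 1) ++ xiIter k b' n).length)).2 ≠ 1 := by
  intro h₁
  have hmod := (h.mod_eq_of_xiIter_append (by omega) (j := 0) ho h₁).1
  obtain ⟨m, rfl⟩ := Nat.dvd_of_mod_eq_zero hmod
  rw [mul_comm k m] at *
  match m with
  | 0 => omega
  | 1 =>
    rw [one_mul, show k + 2 * k - 1 = k - 1 + 2 * k by omega] at ho h₁
    exact h.not_followed_by_one hk (by rw [Nat.mul_mod_left]; omega) ho h₁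
  | m + 2 =>
    rw [List.length_append, ← add_assoc] at h₁
    exact h.xiIter_mul_not_followed_by_one hk (occursAt_append.1 ho).2 h₁

theorem square_not_followed_by_succ (h : IsCutting k u φ) (hk : 3 ≤ k) {t p : ℕ} {b : Bool}
    (ht : t + 2 ≤ k) (ho : OccursAt (xiIter k b (k + t) ++ xiIter k b (k + t)) u p) :
    (u (p + (xiIter k b (k + t) ++ xiIter k b (k + t)).length)).2 ≠ t + 1 := by
  induction t generalizing p with
  | zero =>
    have := h.not_followed_by_one hk (s := 1) (b := b) (b' := b) (p := p)
      (by rw [Nat.mod_eq_of_lt (by omega)]; omega)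
    rw [show k - 1 + 1 = k by omega] at this
    exact this ho
  | succ t ih =>
    intro h₀
    rw [← add_assoc, xiIter_succ, ← xiW_append] at ho h₀
    obtain ⟨i, rfl, h₁, h₂⟩ := h.desubstitute
      (by simp [xiIter_ne_nil (show 2 ≤ k by omega)]) ho (by omega)
    have h₃ := ih (by omega) h₁
    rw [h₂, xiFirst] at h₀
    split_ifs at h₀ <;> (try simp only at h₀) <;> omega

theorem square_not_followed (h : IsCutting k u φ) (hk : 4 ≤ k) {s p : ℕ} {b : Bool}
    (hs : s + 1 ≤ 2 * k) (ho : OccursAt (xiIter k b s ++ xiIter k b s) u p) :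
    u (p + (xiIter k b s ++ xiIter k b s).length) ≠ (b, 0) := by
  induction s generalizing p with
  | zero =>
    intro h₀
    exact h.not_followed_by_zero (s := 0) (by omega) (by simp; omega) (by omega) ho
      (congrArg Prod.snd h₀)
  | succ s ih =>
    intro h₀
    rw [xiIter_succ, ← xiW_append] at ho h₀
    obtain ⟨i, rfl, h₁, h₂⟩ := h.desubstitute
      (by simp [xiIter_ne_nil (show 2 ≤ k by omega)]) ho (by simp [h₀])
    have h₃ := ih (by omega) h₁
    rw [h₂, xiFirst] at h₀
    split_ifs at h₀ with h₄ h₅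
    · exact h₃ h₀
    · have h₆ := h.mod_eq_of_xiIter_append (by omega) (j := k - 2) h₁ (by omega)
      by_cases hlt : s < k
      · rw [h₆.2 hlt] at h₀
        simp at h₀
      · have : s = k + (k - 2) := by
          obtain ⟨r, rfl⟩ := Nat.exists_eq_add_of_le (not_lt.1 hlt)
          rw [Nat.add_mod_left, Nat.mod_eq_of_lt (by omega)] at h₆
          omega
        subst this
        exact h.square_not_followed_by_succ (by omega) (by omega) h₁ (by omega)
    · simp at h₀

end IsCutting

/-- Distinct occurrences of the bispecial factor `ξ^{n+2k−1}(0)ξ^n(0)` do not overlap. -/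
theorem IsCutting.add_length_le {k : ℕ} {u : ℕ → Letter} {φ : ℕ → ℕ} (h : IsCutting k u φ)
    (hk : 4 ≤ k) {b : Bool} {n p q : ℕ} (hpq : p < q)
    (hp : OccursAt (xiIter k b (n + 2 * k - 1) ++ xiIter k b n) u p)
    (hq : OccursAt (xiIter k b (n + 2 * k - 1) ++ xiIter k b n) u q) :
    p + (xiIter k b (n + 2 * k - 1) ++ xiIter k b n).length ≤ q := by
  induction n generalizing p q with
  | zero =>
    by_contra! hlt
    obtain ⟨hp₁, hp₂⟩ := occursAt_append.1 hp
    obtain ⟨hq₁, hq₂⟩ := occursAt_append.1 hq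
    obtain ⟨t, ht, hbt⟩ := xiIter_add_eq_cons (show 2 ≤ k by omega) b (show k - 1 < k by omega)
    rw [show k - 1 + k = 0 + 2 * k - 1 by omega] at ht
    have hqb : u q = (b, 0) := by
      rw [ht] at hq₁
      exact (occursAt_cons.1 hq₁).1
    have hle : p + (xiIter k b (0 + 2 * k - 1)).length ≤ q := by
      by_contra! hlt'
      rw [ht] at hp₁ hlt'
      have hget := hp₁ (q - p) (by omega)
      rw [Nat.add_sub_cancel' hpq.le, hqb, show q - p = q - p - 1 + 1 by omega,
        List.getElem?_cons_succ] at hget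
      exact hbt (List.mem_of_getElem? hget)
    rw [List.length_append, show (xiIter k b 0).length = 1 from rfl] at hlt
    obtain rfl : q = p + (xiIter k b (0 + 2 * k - 1)).length := by omega
    refine h.square_not_followed hk (by omega) (occursAt_append.2 ⟨hp₁, hq₁⟩) ?_
    rw [List.length_append, ← add_assoc]
    exact occursAt_singleton.1 hq₂
  | succ n ih =>
    have hp' := h.bispecial_not_followed_by_one (by omega) (by omega) hp
    have hq' := h.bispecial_not_followed_by_one (by omega) (by omega) hq
    rw [show n + 1 + 2 * k - 1 = n + 2 * k - 1 + 1 by omega, xiIter_succ, xiIter_succ,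
      ← xiW_append] at hp hq hp' hq' ⊢
    have hne : xiIter k b (n + 2 * k - 1) ++ xiIter k b n ≠ [] := by
      simp [xiIter_ne_nil (show 2 ≤ k by omega)]
    obtain ⟨i, rfl, -⟩ := h.desubstitute hne hp hp'
    obtain ⟨j, rfl, -⟩ := h.desubstitute hne hq hq'
    obtain ⟨hi, hi'⟩ := h.desubstitute_aux hp hp'
    obtain ⟨hj, -⟩ := h.desubstitute_aux hq hq'
    rw [← hi']
    exact h.strictMono.monotone (ih (h.strictMono.lt_iff_lt.1 hpq) hi hj)

/-- for `k ≥ 4` and every `n`, every return word to the bispecial factor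
`w = ξ^{n+2k−1}(0)ξ^n(0)` in `u_k` has length at least `|w|`. -/
theorem stmt_8 (k : ℕ) (hk : 4 ≤ k) (u : ℕ → Letter) (hu : IsFixedPoint k u) :
    ∀ n : ℕ, ∀ r : List Letter,
      ReturnWordTo r (xiPow k (n + 2 * k - 1) ++ xiPow k n) u →
      (xiPow k (n + 2 * k - 1) ++ xiPow k n).length ≤ r.length := by
  rintro n r ⟨j, l, hjl, hj, hl, -, rfl⟩
  obtain ⟨φ, h⟩ := hu.exists_isCutting
  have := h.add_length_le (b := false) hk hjl hj hl
  rw [List.length_map, List.length_range]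
  exact Nat.le_sub_of_add_le' this
end

section
/- Let k ≥ 4. Let u = u_1⋯u_n and v = v_1⋯v_n be factors of u_k of the same length n such that π(u) = π(v) and u_ℓ ≠ v_ℓ for every ℓ = 1,…,n. Then n ≤ k+1. -/
open List Filter Topology

/-- A letter together with the size of the maximal ascending block `0 1 ⋯ m` containing it:
`(b, m, r)` stands for the letter `(b, r)` inside the block `(b, 0) (b, 1) ⋯ (b, m)`. -/
abbrev BlockLetter : Type := Bool × ℕ × ℕ

namespace BlockLetter

/-- Forget the block containing a letter. -/
def letter (x : BlockLetter) : Letter := (x.1, x.2.2)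

/-- The lift of `xiL k` to letters with blocks. -/
def xi (k : ℕ) (x : BlockLetter) : List BlockLetter :=
  if x.2.2 = 0 then [(x.1, min (x.2.1 + 1) (k - 1), 0), (x.1, min (x.2.1 + 1) (k - 1), 1)]
  else if x.2.2 = k - 1 then [(!x.1, 0, 0)]
  else [(x.1, min (x.2.1 + 1) (k - 1), x.2.2 + 1)]

/-- The offset of a letter lies within its block, and blocks have at most `k` letters. -/
def Valid (k : ℕ) (x : BlockLetter) : Prop := x.2.2 ≤ x.2.1 ∧ x.2.1 < k

/-- The possible successions of two letters with blocks. -/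
def Next (k : ℕ) (x y : BlockLetter) : Prop :=
  (x.2.2 < x.2.1 ∧ y.1 = x.1 ∧ y.2.1 = x.2.1 ∧ y.2.2 = x.2.2 + 1) ∨
  (x.2.2 = x.2.1 ∧ y.2.2 = 0 ∧
    (y.2.1 = k - 1 ∨ (x.2.1 = k - 1 ∧ y.1 = !x.1 ∧ y.2.1 = 0) ∨
      (x.2.1 < k - 1 ∧ y.1 = x.1 ∧ y.2.1 = x.2.1 + 1)))

theorem map_letter_xi (k : ℕ) (x : BlockLetter) : (xi k x).map letter = xiL k x.letter := by
  unfold xi xiL letter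
  split_ifs <;> simp

theorem valid_of_mem_xi {k : ℕ} (hk : 4 ≤ k) {x y : BlockLetter} (hx : x.Valid k)
    (hy : y ∈ xi k x) : y.Valid k := by
  unfold xi at hy
  unfold Valid at *
  split_ifs at hy <;> simp at hy <;> rcases hy with rfl | rfl <;> simp <;> omega

theorem isChain_xi {k : ℕ} (hk : 4 ≤ k) {x : BlockLetter} :
    (xi k x).IsChain (Next k) := by
  unfold xi
  split_ifs <;> grind [Next]

theorem next_of_mem_xi {k : ℕ} (hk : 4 ≤ k) {x y : BlockLetter} (hx : x.Valid k)
    (hy : y.Valid k) (hxy : Next k x y) :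
    ∀ a ∈ (xi k x).getLast?, ∀ b ∈ (xi k y).head?, Next k a b := by
  obtain ⟨c, m, r⟩ := x
  obtain ⟨c', m', r'⟩ := y
  unfold xi
  simp only [Valid, Next] at *
  split_ifs <;> simp <;> grind

theorem isChain_flatMap_xi {k : ℕ} (hk : 4 ≤ k) (L : List BlockLetter)
    (hv : ∀ x ∈ L, x.Valid k) (hL : L.IsChain (Next k)) :
    (L.flatMap (xi k)).IsChain (Next k) := by
  induction L with
  | nil => simp
  | cons x L ih =>
    rw [List.flatMap_cons, List.isChain_append]
    refine ⟨isChain_xi hk, ih (fun y hy => hv y (by simp [hy])) hL.tail, ?_⟩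
    cases L with
    | nil => simp
    | cons y L =>
      intro a ha b hb
      refine next_of_mem_xi hk (hv x (by simp)) (hv y (by simp)) (by simp_all) a ha b ?_
      rw [List.flatMap_cons, List.head?_append] at hb
      have hne : xi k y ≠ [] := by unfold xi; split_ifs <;> simp
      obtain ⟨z, l, hz⟩ := List.exists_cons_of_ne_nil hne
      simpa [hz] using hb

theorem exists_lift_xiPow {k : ℕ} (hk : 4 ≤ k) (n : ℕ) :
    ∃ L : List BlockLetter, (∀ x ∈ L, x.Valid k) ∧ L.IsChain (Next k) ∧
      L.map letter = xiPow k n := by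
  induction n with
  | zero => exact ⟨[(false, 0, 0)], by simp [Valid]; omega, by simp, by simp [letter, xiPow]⟩
  | succ n ih =>
    obtain ⟨L, hv, hL, h⟩ := ih
    refine ⟨L.flatMap (xi k), ?_, isChain_flatMap_xi hk L hv hL, ?_⟩
    · intro y hy
      obtain ⟨x, hx, hxy⟩ := List.mem_flatMap.1 hy
      exact valid_of_mem_xi hk (hv x hx) hxy
    · rw [xiPow, Function.iterate_succ_apply', ← xiPow, ← h, xiW, List.map_flatMap,
        List.flatMap_map]
      simp only [map_letter_xi]

end BlockLetter

theorem length_le_length_xiW (k : ℕ) (w : List Letter) : w.length ≤ (xiW k w).length := by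
  induction w with
  | nil => simp
  | cons a w ih =>
    have : 1 ≤ (xiL k a).length := by unfold xiL; split_ifs <;> simp
    simp only [xiW, List.flatMap_cons, List.length_append, List.length_cons] at *
    omega

theorem exists_xiPow_eq_cons (k n : ℕ) :
    ∃ w, xiPow k n = (false, 0) :: w ∧ n ≤ w.length := by
  induction n with
  | zero => exact ⟨[], rfl, le_rfl⟩
  | succ n ih =>
    obtain ⟨w, hw, hn⟩ := ih
    refine ⟨(false, 1) :: xiW k w, ?_, ?_⟩
    · rw [xiPow, Function.iterate_succ_apply', ← xiPow, hw]
      simp [xiW, xiL]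
    · have := length_le_length_xiW k w
      simp only [List.length_cons]
      omega

/-- Constraints on five consecutive letters of `u_k`. -/
structure Window (k : ℕ) (x₀ x₁ x₂ x₃ x₄ : Letter) : Prop where
  lt : x₀.2 < k
  succ : x₁.2 = 0 ∨ (x₁.2 = x₀.2 + 1 ∧ x₁.1 = x₀.1)
  zero_zero : x₀.2 = 0 → x₁.2 = 0 → x₂.2 = 1
  pos_zero_one : x₀.2 ≠ 0 → x₁.2 = 0 → x₂.2 = 1 → x₃.2 = 2
  pos_zero_zero : x₀.2 ≠ 0 → x₁.2 = 0 → x₂.2 = 0 → x₀.2 = k - 1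
  zero_zero_one_two : x₀.2 = 0 → x₁.2 = 0 → x₂.2 = 1 → x₃.2 = 2 → x₄.2 = 3
  flip : x₀.2 ≠ 0 → x₁.2 = 0 → x₂.2 = 1 → x₃.2 = 2 → x₄.2 = 0 → x₁.1 = x₀.1

theorem IsFixedPoint.window {k : ℕ} (hk : 4 ≤ k) {u : ℕ → Letter} (hu : IsFixedPoint k u)
    (i : ℕ) : Window k (u i) (u (i + 1)) (u (i + 2)) (u (i + 3)) (u (i + 4)) := by
  obtain ⟨L, hv, hL, h⟩ := BlockLetter.exists_lift_xiPow hk (i + 5)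
  obtain ⟨w, hw, hlen⟩ := exists_xiPow_eq_cons k (i + 5)
  have hlenL : i + 5 < L.length := by
    have := congrArg List.length h
    rw [hw, List.length_map, List.length_cons] at this
    omega
  have key : ∀ j (hj : j < L.length), u j = (L[j]).letter := by
    intro j hj
    have := hu (i + 5) j (by rw [← h]; simpa using hj)
    rw [← h] at this
    simpa [hj, eq_comm] using this
  rw [List.isChain_iff_getElem] at hL
  rw [key i (by omega), key (i + 1) (by omega), key (i + 2) (by omega), key (i + 3) (by omega),
    key (i + 4) (by omega)]
  have h0 := hL i (by omega)
  have h1 := hL (i + 1) (by omega)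
  have h2 := hL (i + 2) (by omega)
  have h3 := hL (i + 3) (by omega)
  have v0 := hv L[i] (List.getElem_mem _)
  have v1 := hv L[i + 1] (List.getElem_mem _)
  have v2 := hv L[i + 2] (List.getElem_mem _)
  have v3 := hv L[i + 3] (List.getElem_mem _)
  have v4 := hv L[i + 4] (List.getElem_mem _)
  generalize L[i] = y0 at *
  generalize L[i + 1] = y1 at *
  generalize L[i + 2] = y2 at *
  generalize L[i + 3] = y3 at *
  generalize L[i + 4] = y4 at *
  obtain ⟨c0, m0, r0⟩ := y0
  obtain ⟨c1, m1, r1⟩ := y1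
  obtain ⟨c2, m2, r2⟩ := y2
  obtain ⟨c3, m3, r3⟩ := y3
  obtain ⟨c4, m4, r4⟩ := y4
  clear hv hL key h hw hu
  simp only [BlockLetter.Valid, BlockLetter.Next, BlockLetter.letter] at *
  constructor <;> simp only <;> grind

/-- Distinct letters with the same image under `proj`. -/
def Clash (a b : Letter) : Prop := a ≠ b ∧ proj a = proj b

theorem Clash.symm {a b : Letter} (h : Clash a b) : Clash b a := ⟨h.1.symm, h.2.symm⟩

theorem Clash.spec {a b : Letter} (h : Clash a b) :
    a.2 ≠ b.2 ∧ (a.2 = 0 → b.1 = !a.1) ∧ (b.2 = 0 → b.1 = !a.1) ∧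
      (a.2 ≠ 0 → b.2 ≠ 0 → b.1 = a.1) := by
  obtain ⟨c, m⟩ := a
  obtain ⟨d, l⟩ := b
  obtain ⟨h1, h2⟩ := h
  simp only [proj, ne_eq, Prod.mk.injEq] at *
  cases c <;> cases d <;> grind

/-- If the first position where a type-zero letter occurs in a clashing pair is `p`, and it occurs
in the second word, then the words cannot have length `k + 2`. -/
theorem false_of_first_zero {k : ℕ} (hk : 4 ≤ k) {S T : ℕ → Letter}
    (hS : ∀ i, Window k (S i) (S (i + 1)) (S (i + 2)) (S (i + 3)) (S (i + 4)))
    (hT : ∀ i, Window k (T i) (T (i + 1)) (T (i + 2)) (T (i + 3)) (T (i + 4)))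
    (hc : ∀ i < k + 2, Clash (S i) (T i)) {p : ℕ} (hT0 : (T p).2 = 0)
    (hSp : p + 1 ≤ (S p).2) (hpre : ∀ i < p, (S i).2 ≠ 0 ∧ (T i).2 ≠ 0) : False := by
  have hlt := (hS p).lt
  have c0 := (hc p (by omega)).spec
  have c1 := (hc (p + 1) (by omega)).spec
  have c2 := (hc (p + 2) (by omega)).spec
  have c3 := (hc (p + 3) (by omega)).spec
  obtain ⟨-, s0, -, s0a, s0b, -, -⟩ := hS p
  obtain ⟨-, s1, s1z, s1a, s1b, -, -⟩ := hS (p + 1)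
  obtain ⟨-, s2, s2z, s2a, s2b, -, -⟩ := hS (p + 2)
  obtain ⟨-, t0, t0z, t0a, t0b, t0c, -⟩ := hT p
  obtain ⟨-, t1, t1z, t1a, t1b, -, -⟩ := hT (p + 1)
  obtain ⟨-, t2, t2z, t2a, t2b, -, -⟩ := hT (p + 2)
  obtain ⟨-, s3, s3z, s3a, s3b, -, -⟩ := hS (p + 3)
  obtain ⟨-, t3, t3z, t3a, t3b, -, -⟩ := hT (p + 3)
  by_cases h1 : (T (p + 1)).2 = 0
  · have hS1 : (S (p + 1)).2 = (S p).2 + 1 := by grind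
    have hlt1 := (hS (p + 1)).lt
    have c4 := (hc (p + 4) (by omega)).spec
    have hT2 : (T (p + 2)).2 = 1 := t0z hT0 h1
    have hS2 : (S (p + 2)).2 = 0 := by grind
    by_cases h3 : (S (p + 3)).2 = 0 <;> grind
  · have hS1 : (S (p + 1)).2 = 0 := by grind
    by_cases h2 : (S (p + 2)).2 = 0
    · have hT2 : (T (p + 2)).2 = 2 := by grind
      have hS3 : (S (p + 3)).2 = 1 := s1z hS1 h2
      have hT3 : (T (p + 3)).2 = 0 := by grind
      rcases p with - | p
      · have c4 := (hc 4 (by omega)).spec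
        have c5 := (hc 5 (by omega)).spec
        have s4 := (hS 4).succ
        have t4 := (hT 4).succ
        have hT4 : (T 4).2 = 1 := by grind
        have hS4 : (S 4).2 = 0 := by grind
        grind
      · have cp := (hc p (by omega)).spec
        have sp := (hS p).succ
        have tp := (hT p).flip
        have := hpre p (by omega)
        grind
    · grind

theorem false_of_clash {k : ℕ} (hk : 4 ≤ k) {S T : ℕ → Letter}
    (hS : ∀ i, Window k (S i) (S (i + 1)) (S (i + 2)) (S (i + 3)) (S (i + 4)))
    (hT : ∀ i, Window k (T i) (T (i + 1)) (T (i + 2)) (T (i + 3)) (T (i + 4)))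
    (hc : ∀ i < k + 2, Clash (S i) (T i)) : False := by
  have rise : ∀ {V : ℕ → Letter},
      (∀ i, Window k (V i) (V (i + 1)) (V (i + 2)) (V (i + 3)) (V (i + 4))) →
      ∀ p, (∀ i ≤ p, (V i).2 ≠ 0) → p + 1 ≤ (V p).2 := by
    intro V hV p hp
    induction p with
    | zero => have := hp 0 le_rfl; omega
    | succ p ih =>
      have := ih fun i hi => hp i (by omega)
      have := hp (p + 1) le_rfl
      have := (hV p).succ
      omega
  have hex : ∃ p, (S p).2 = 0 ∨ (T p).2 = 0 := by
    by_contra! h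
    have := rise hS k fun i _ => (h i).1
    have := (hS k).lt
    omega
  have hpre : ∀ i < Nat.find hex, (S i).2 ≠ 0 ∧ (T i).2 ≠ 0 := fun i hi =>
    not_or.1 (Nat.find_min hex hi)
  have hspec := Nat.find_spec hex
  generalize Nat.find hex = p at hpre hspec
  have hp : p < k + 2 := by
    by_contra hp
    have := rise hS k fun i hi => (hpre i (by omega)).1
    have := (hS k).lt
    omega
  have hne := (hc p hp).spec.1
  rcases hspec with h | h
  · refine false_of_first_zero hk hT hS (fun i hi => (hc i hi).symm) h (rise hT p fun i hi => ?_)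
      fun i hi => (hpre i hi).symm
    rcases hi.lt_or_eq with hi | rfl
    · exact (hpre i hi).2
    · omega
  · refine false_of_first_zero hk hS hT hc h (rise hS p fun i hi => ?_) hpre
    rcases hi.lt_or_eq with hi | rfl
    · exact (hpre i hi).1
    · omega

/-- for `k ≥ 4`, if `s` and `t` are factors of `u_k` of the same length
`n` with `π(s) = π(t)` and `s_ℓ ≠ t_ℓ` for every position `ℓ`, then `n ≤ k + 1`. -/
theorem stmt_11 (k : ℕ) (hk : 4 ≤ k) (u : ℕ → Letter) (hu : IsFixedPoint k u)
    (s t : List Letter) (hs : FactorOf s u) (ht : FactorOf t u)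
    (hlen : s.length = t.length) (hproj : s.map proj = t.map proj)
    (hne : ∀ i : ℕ, i < s.length → s[i]? ≠ t[i]?) :
    s.length ≤ k + 1 := by
  by_contra! hlt
  obtain ⟨a, ha⟩ := hs
  obtain ⟨b, hb⟩ := ht
  refine false_of_clash hk (S := fun i => u (a + i)) (T := fun i => u (b + i))
    (fun i => hu.window hk (a + i)) (fun i => hu.window hk (b + i)) fun i hi => ?_
  have hsi := ha i (by omega)
  have hti := hb i (by omega)
  have hpi := congrArg (·[i]?) hproj
  have hni := hne i (by omega)
  simp only [List.getElem?_map, hsi, hti, Option.map_some, Option.some.injEq] at hpi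
  rw [hsi, hti] at hni
  exact ⟨fun h => hni (congrArg some h), hpi⟩
end

section
/- Let k ≥ 4. Let u = u_1⋯u_n and v = v_1⋯v_n be factors of u_k of the same length n such that π(u) = π(v) and u_ℓ ≠ v_ℓ for every ℓ = 1,…,n. If moreover both u0 and v0 are factors of u_k, or both u0′ and v0′ are factors of u_k, then n ≤ k−1 and π(u) = π(v) equals 1^n or 0^n. -/
open List Filter Topology

/-- The local rule obeyed by three consecutive letters of `u_k`. -/
def WindowRule (k : ℕ) (a b c : Letter) : Prop :=
  c.2 ≤ k - 1 ∧ (1 ≤ c.2 → b = (c.1, c.2 - 1)) ∧ (b.2 = 0 → c.2 = 0 → a = (!b.1, k - 1))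

/-- Every window of length three of `a :: b :: w` obeys `WindowRule`. -/
def WindowValid (k : ℕ) : Letter → Letter → List Letter → Prop
  | _, _, [] => True
  | a, b, c :: w => WindowRule k a b c ∧ WindowValid k b c w

/-- The last letter of `ξ_k(a)`. -/
def xiLast (k : ℕ) (a : Letter) : Letter :=
  if a.2 = 0 then (a.1, 1) else if a.2 = k - 1 then (!a.1, 0) else (a.1, a.2 + 1)

/-- The last but one letter of `ξ_k(ab)`. -/
def xiPenult (k : ℕ) (a b : Letter) : Letter :=
  if b.2 = 0 then (b.1, 0) else xiLast k a

theorem WindowValid.xiW {k : ℕ} (hk : 4 ≤ k) (w : List Letter) (a b : Letter)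
    (hab : 1 ≤ b.2 → a = (b.1, b.2 - 1)) (h : WindowValid k a b w) :
    WindowValid k (xiPenult k a b) (xiLast k b) (xiW k w) := by
  induction w generalizing a b with
  | nil => simp [_root_.xiW, WindowValid]
  | cons c w ih =>
    obtain ⟨⟨hc, hbc, habc⟩, hw⟩ := h
    have IH := ih b c hbc hw
    obtain ⟨b1, b2⟩ := b
    obtain ⟨c1, c2⟩ := c
    have e : _root_.xiW k ((c1, c2) :: w) = xiL k (c1, c2) ++ _root_.xiW k w := by
      simp [_root_.xiW]
    rw [e]
    dsimp only at hc hbc habc hab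
    by_cases h0 : c2 = 0
    · subst h0
      simp only [xiL, xiPenult, xiLast, if_true, List.cons_append, List.nil_append,
        WindowValid] at IH ⊢
      refine ⟨⟨by simp, by simp, ?_⟩, ⟨by simp; omega, by simp, by simp⟩, IH⟩
      intro hb _
      by_cases hb0 : b2 = 0
      · simp [hb0] at hb
      · by_cases hbk : b2 = k - 1
        · have := hab (by omega)
          subst this
          have h1 : ¬ b2 - 1 = 0 := by omega
          have h2 : ¬ b2 - 1 = k - 1 := by omega
          have h3 : b2 - 1 + 1 = k - 1 := by omega
          simp [hb0, h1, h2, h3, if_pos hbk]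
        · simp [hb0, hbk] at hb
    · have hb := hbc (by omega)
      simp only [Prod.mk.injEq] at hb
      obtain ⟨rfl, rfl⟩ := hb
      have hlast : xiLast k (b1, c2 - 1) = (b1, c2) := by
        simp only [xiLast]
        split_ifs with h1 h2
        · simp only [Prod.mk.injEq, true_and]; omega
        · omega
        · simp only [Prod.mk.injEq, true_and]; omega
      have hL : xiL k (b1, c2) = [xiLast k (b1, c2)] := by
        simp only [xiL, xiLast, h0, if_false]
        split_ifs <;> rfl
      have hP : xiPenult k (b1, c2 - 1) (b1, c2) = xiLast k (b1, c2 - 1) := by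
        simp [xiPenult, h0]
      rw [hP, hlast] at IH
      rw [hL, hlast]
      refine ⟨?_, IH⟩
      simp only [xiLast, h0, if_false]
      split_ifs with h1
      · exact ⟨by simp, by simp, fun h => absurd h h0⟩
      · exact ⟨by dsimp only; omega, by simp, fun h => absurd h h0⟩

theorem WindowValid.windowRule {k : ℕ} (w : List Letter) (a b x y z : Letter)
    (h : WindowValid k a b w) (i : ℕ) (hx : (a :: b :: w)[i]? = some x)
    (hy : (a :: b :: w)[i + 1]? = some y) (hz : (a :: b :: w)[i + 2]? = some z) :
    WindowRule k x y z := by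
  induction w generalizing a b i with
  | nil => simp at hz
  | cons c w ih =>
    cases i with
    | zero =>
      simp at hx hy hz
      subst hx hy hz
      exact h.1
    | succ i => exact ih b c h.2 i (by simpa using hx) (by simpa using hy) (by simpa using hz)

theorem xiPow_succ_eq {k : ℕ} (hk : 4 ≤ k) (n : ℕ) :
    ∃ w, xiPow k (n + 1) = (false, 0) :: (false, 1) :: w ∧ n ≤ w.length ∧
      WindowValid k (false, 0) (false, 1) w := by
  induction n with
  | zero => exact ⟨[], by simp [xiPow, xiW, xiL], by simp, trivial⟩
  | succ n ih =>
    obtain ⟨w, hw, hl, hv⟩ := ih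
    have h1 : xiLast k (false, 1) = (false, 2) := by
      simp only [xiLast]
      rw [if_neg (by omega), if_neg (by omega)]
    refine ⟨(false, 2) :: xiW k w, ?_, ?_, ?_⟩
    · have e : xiPow k (n + 1 + 1) = xiW k (xiPow k (n + 1)) := by
        simp only [xiPow, Function.iterate_succ_apply']
      have hk1 : ¬ 1 = k - 1 := by omega
      rw [e, hw]
      simp [xiW, xiL, hk1]
    · have := length_le_length_xiW k w
      simp only [List.length_cons]
      omega
    · have := hv.xiW hk w _ _ (by simp)
      rw [h1] at this
      exact ⟨⟨by dsimp only; omega, by simp, by simp⟩, by simpa [xiPenult, xiLast] using this⟩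

namespace IsFixedPoint

variable {k : ℕ} {u : ℕ → Letter}

theorem windowRule (hk : 4 ≤ k) (hu : IsFixedPoint k u) (i : ℕ) :
    WindowRule k (u i) (u (i + 1)) (u (i + 2)) := by
  obtain ⟨w, hw, hl, hv⟩ := xiPow_succ_eq hk (i + 1)
  have h := hu (i + 1 + 1)
  rw [hw] at h
  have hj : ∀ j, j ≤ i + 2 → ((false, 0) :: (false, 1) :: w)[j]? = some (u j) := by
    intro j hj
    have := h j (by simp only [List.length_cons]; omega)
    rwa [Nat.zero_add] at this
  exact hv.windowRule w _ _ _ _ _ i (hj _ (by omega)) (hj _ (by omega)) (hj _ (by omega))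

theorem apply_zero_one (hk : 4 ≤ k) (hu : IsFixedPoint k u) :
    u 0 = (false, 0) ∧ u 1 = (false, 1) := by
  obtain ⟨w, hw, -, -⟩ := xiPow_succ_eq hk 0
  have h := hu (0 + 1)
  rw [hw] at h
  have h0 := h 0 (by simp)
  have h1 := h 1 (by simp)
  simp at h0 h1
  exact ⟨h0.symm, h1.symm⟩

theorem index_le (hk : 4 ≤ k) (hu : IsFixedPoint k u) (i : ℕ) : (u i).2 ≤ k - 1 := by
  match i with
  | 0 => simp [(hu.apply_zero_one hk).1]
  | 1 => simp only [(hu.apply_zero_one hk).2]; omega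
  | i + 2 => exact (hu.windowRule hk i).1

theorem apply_pred (hk : 4 ≤ k) (hu : IsFixedPoint k u) (i : ℕ) (h : 1 ≤ (u (i + 1)).2) :
    u i = ((u (i + 1)).1, (u (i + 1)).2 - 1) := by
  match i with
  | 0 => simp [hu.apply_zero_one hk]
  | i + 1 => exact (hu.windowRule hk i).2.1 h

theorem apply_sub (hk : 4 ≤ k) (hu : IsFixedPoint k u) (d i : ℕ) (h : d ≤ (u (i + d)).2) :
    u i = ((u (i + d)).1, (u (i + d)).2 - d) := by
  induction d with
  | zero => simp
  | succ d ih =>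
    have := hu.apply_pred hk (i + d) (by rw [Nat.add_assoc]; omega)
    rw [Nat.add_assoc] at this
    rw [this] at ih
    rw [ih (by dsimp only; omega)]
    simp only [Prod.mk.injEq, true_and]
    omega

/-- Two aligned factors of length `n` with equal projections, distinct letters everywhere and
followed by letters of index `0` are short and have constant projection; the last letter of the
first one is assumed to have the smaller index. -/
theorem aligned_of_lt (hk : 4 ≤ k) (hu : IsFixedPoint k u) (p q n : ℕ)
    (hpr : ∀ i ≤ n, proj (u (p + i)) = proj (u (q + i)))
    (hp : (u (p + n + 1)).2 = 0) (hlt : (u (p + n)).2 < (u (q + n)).2) :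
    n + 1 ≤ k - 1 ∧ ∃ β, ∀ i ≤ n, proj (u (p + i)) = β := by
  have hback : ∀ r d i, d + i = n → d ≤ (u (r + n)).2 →
      u (r + i) = ((u (r + n)).1, (u (r + n)).2 - d) := by
    intro r d i hd h
    have e : r + n = r + i + d := by omega
    rw [e] at h ⊢
    exact hu.apply_sub hk d _ h
  have hlast := hpr n le_rfl
  have hqk := hu.index_le hk (q + n)
  have hpk := hu.index_le hk (p + n)
  obtain ⟨b, m, hbm⟩ : ∃ b m, u (p + n) = (b, m) := ⟨_, _, rfl⟩
  obtain ⟨c, l, hcl⟩ : ∃ c l, u (q + n) = (c, l) := ⟨_, _, rfl⟩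
  have hp' := hback p
  have hq' := hback q
  rw [hbm] at hlast hlt hpk hp'
  rw [hcl] at hlast hlt hqk hq'
  dsimp only at hlt hqk hpk hp' hq'
  have hl0 : l ≠ 0 := by omega
  rcases Nat.eq_zero_or_pos m with rfl | hm
  · simp only [proj, if_true, hl0, if_false] at hlast
    subst hlast
    have hnl : n < l := by
      by_contra! hcon
      obtain ⟨d, rfl⟩ : ∃ d, n = d + l := ⟨n - l, by omega⟩
      obtain ⟨e, rfl⟩ : ∃ e, l = e + 1 := ⟨l - 1, by omega⟩
      have h2 := (hu.windowRule hk (p + d + e)).2.2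
      rw [show p + d + e + 1 = p + (d + (e + 1)) by omega,
        show p + d + e + 2 = p + (d + (e + 1)) + 1 by omega, hbm] at h2
      have h3 := h2 rfl hp
      have h4 := hu.apply_sub hk e (p + d) (by rw [h3]; dsimp only; omega)
      rw [h3] at h4
      have h5 := hpr d (by omega)
      rw [h4, hq' (e + 1) d (by omega) le_rfl] at h5
      simp only [proj, Nat.sub_self, if_true] at h5
      rw [if_neg (by omega)] at h5
      simp at h5
    refine ⟨by omega, !c, fun i hi => ?_⟩
    rw [hpr i hi, hq' (n - i) i (by omega) (by omega)]
    simp only [proj]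
    rw [if_neg (by omega)]
  · have hm0 : m ≠ 0 := by omega
    simp only [proj, hm0, hl0, if_false] at hlast
    have hbc : b = c := by simpa using hlast
    subst hbc
    have hnm : n < m := by
      by_contra! hcon
      have h5 := hpr (n - m) (by omega)
      rw [hp' m (n - m) (by omega) le_rfl, hq' m (n - m) (by omega) (by omega)] at h5
      simp only [proj, Nat.sub_self, if_true] at h5
      rw [if_neg (by omega)] at h5
      simp at h5
    refine ⟨by omega, !b, fun i hi => ?_⟩
    rw [hp' (n - i) i (by omega) (by omega)]
    simp only [proj]
    rw [if_neg (by omega)]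

theorem aligned (hk : 4 ≤ k) (hu : IsFixedPoint k u) (p q n : ℕ)
    (hpr : ∀ i < n, proj (u (p + i)) = proj (u (q + i)))
    (hne : ∀ i < n, u (p + i) ≠ u (q + i))
    (hp : (u (p + n)).2 = 0) (hq : (u (q + n)).2 = 0) :
    n ≤ k - 1 ∧ ∃ β, ∀ i < n, proj (u (p + i)) = β := by
  cases n with
  | zero => exact ⟨by omega, true, by simp⟩
  | succ n =>
    simp only [Nat.lt_succ_iff] at *
    rcases lt_trichotomy (u (p + n)).2 (u (q + n)).2 with h | h | h
    · exact hu.aligned_of_lt hk p q n hpr hp h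
    · refine absurd (Prod.ext ?_ h) (hne n le_rfl)
      have := hpr n le_rfl
      simp only [proj, h] at this
      split_ifs at this
      · exact this
      · simpa using this
    · obtain ⟨h1, β, h2⟩ := hu.aligned_of_lt hk q p n (fun i hi => (hpr i hi).symm) hq h
      exact ⟨h1, β, fun i hi => (hpr i hi).trans (h2 i hi)⟩

end IsFixedPoint

theorem OccursAt.of_append_singleton {α : Type*} {w : List α} {a : α} {v : ℕ → α} {j : ℕ}
    (h : OccursAt (w ++ [a]) v j) : OccursAt w v j ∧ v (j + w.length) = a := by
  constructor
  · intro i hi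
    rw [← h i (by simp; omega), List.getElem?_append_left hi]
  · have := h w.length (by simp)
    simpa using this.symm

/-- for `k ≥ 4`, if `s` and `t` are factors of `u_k` of the same length
`n` with `π(s) = π(t)` and `s_ℓ ≠ t_ℓ` for every position `ℓ`, and moreover `s0, t0`
are both factors of `u_k` or `s0′, t0′` are both factors of `u_k`, then `n ≤ k − 1`
and `π(s) = π(t)` equals `1^n` or `0^n`. -/
theorem stmt_12 (k : ℕ) (hk : 4 ≤ k) (u : ℕ → Letter) (hu : IsFixedPoint k u)
    (s t : List Letter) (hs : FactorOf s u) (ht : FactorOf t u)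
    (hlen : s.length = t.length) (hproj : s.map proj = t.map proj)
    (hne : ∀ i : ℕ, i < s.length → s[i]? ≠ t[i]?)
    (hext : (FactorOf (s ++ [((false : Bool), (0 : ℕ))]) u ∧
             FactorOf (t ++ [((false : Bool), (0 : ℕ))]) u) ∨
            (FactorOf (s ++ [((true : Bool), (0 : ℕ))]) u ∧
             FactorOf (t ++ [((true : Bool), (0 : ℕ))]) u)) :
    s.length ≤ k - 1 ∧
      (s.map proj = List.replicate s.length true ∨
       s.map proj = List.replicate s.length false) := by
  obtain ⟨c, ⟨p, hp⟩, ⟨q, hq⟩⟩ : ∃ c : Bool, FactorOf (s ++ [(c, 0)]) u ∧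
      FactorOf (t ++ [(c, 0)]) u := by
    rcases hext with h | h
    exacts [⟨_, h⟩, ⟨_, h⟩]
  obtain ⟨hps, hp0⟩ := hp.of_append_singleton
  obtain ⟨hqt, hq0⟩ := hq.of_append_singleton
  have hpr : ∀ i < s.length, proj (u (p + i)) = proj (u (q + i)) := by
    intro i hi
    have h := congrArg (fun l : List Bool => l[i]?) hproj
    simpa [List.getElem?_map, hps i hi, hqt i (hlen ▸ hi)] using h
  have hne' : ∀ i < s.length, u (p + i) ≠ u (q + i) := by
    intro i hi h
    exact hne i hi (by rw [hps i hi, hqt i (hlen ▸ hi), h])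
  obtain ⟨hn, β, hβ⟩ := hu.aligned hk p q s.length hpr hne' (by rw [hp0])
    (by rw [hlen, hq0])
  have hs' : s.map proj = List.replicate s.length β := by
    refine List.eq_replicate_iff.2 ⟨by simp, fun x hx => ?_⟩
    obtain ⟨a, ha, rfl⟩ := List.mem_map.1 hx
    obtain ⟨i, hi, rfl⟩ := List.mem_iff_getElem.1 ha
    have h := hps i hi
    rw [List.getElem?_eq_getElem hi, Option.some.injEq] at h
    rw [h, hβ i hi]
  refine ⟨hn, ?_⟩
  cases β
  · exact Or.inr hs'
  · exact Or.inl hs'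
end
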